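/- Let J : 𝕍 → 𝕍 be a generalized complex structure and let J_ℂ and ⟨·,·⟩_ℂ denote the ℂ-linear and ℂ-bilinear extensions of J and of the natural pairing to the complexification 𝕍 ⊗ ℂ. Then the +i-eigenspace L of J_ℂ is isotropic for ⟨·,·⟩_ℂ (⟨v, w⟩_ℂ = 0 for all v, w ∈ L) and has complex dimension m; that is, L is a maximal isotropic subspace of 𝕍 ⊗ ℂ. -/

import Mathlib

open TensorProduct

noncomputable def gcsRe (W : Type*) [AddCommGroup W] [Module ℝ W] : (ℂ ⊗[ℝ] W) →ₗ[ℝ] W :=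
  (TensorProduct.lid ℝ W).toLinearMap ∘ₗ Complex.reLm.rTensor W

noncomputable def gcsIm (W : Type*) [AddCommGroup W] [Module ℝ W] : (ℂ ⊗[ℝ] W) →ₗ[ℝ] W :=
  (TensorProduct.lid ℝ W).toLinearMap ∘ₗ Complex.imLm.rTensor W

section
variable {W : Type*} [AddCommGroup W] [Module ℝ W]

lemma gcsRe_tmul (z : ℂ) (w : W) : gcsRe W (z ⊗ₜ w) = z.re • w := by simp [gcsRe]
lemma gcsIm_tmul (z : ℂ) (w : W) : gcsIm W (z ⊗ₜ w) = z.im • w := by simp [gcsIm]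

lemma gcs_decomp (x : ℂ ⊗[ℝ] W) :
    x = (1 : ℂ) ⊗ₜ[ℝ] gcsRe W x + Complex.I • ((1 : ℂ) ⊗ₜ[ℝ] gcsIm W x) := by
  induction x with
  | zero => simp
  | tmul z w =>
    rw [gcsRe_tmul, gcsIm_tmul, TensorProduct.smul_tmul', TensorProduct.tmul_smul,
      TensorProduct.tmul_smul, TensorProduct.smul_tmul', TensorProduct.smul_tmul',
      ← TensorProduct.add_tmul]
    congr 1
    apply Complex.ext <;> simp
  | add x y hx hy =>
    simp only [map_add, TensorProduct.tmul_add, smul_add]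
    nth_rewrite 1 [hx, hy]
    abel

lemma gcsRe_I (x : ℂ ⊗[ℝ] W) : gcsRe W (Complex.I • x) = - gcsIm W x := by
  induction x with
  | zero => simp
  | tmul z w => rw [TensorProduct.smul_tmul', gcsRe_tmul, gcsIm_tmul]; simp
  | add x y hx hy => rw [smul_add, map_add, map_add, hx, hy]; abel

lemma gcsRe_J (J : W →ₗ[ℝ] W) (x : ℂ ⊗[ℝ] W) :
    gcsRe W (J.baseChange ℂ x) = J (gcsRe W x) := by
  induction x with
  | zero => simp
  | tmul z w => rw [LinearMap.baseChange_tmul, gcsRe_tmul, gcsRe_tmul]; simp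
  | add x y hx hy => rw [map_add, map_add, map_add, map_add, hx, hy]

lemma gcs_mem {J : W →ₗ[ℝ] W} (hJ : ∀ w, J (J w) = -w) {x : ℂ ⊗[ℝ] W}
    (hx : J.baseChange ℂ x = Complex.I • x) : gcsRe W x = J (gcsIm W x) := by
  have h := congrArg (gcsRe W) hx
  rw [gcsRe_J, gcsRe_I] at h
  have h2 := congrArg J h
  rw [hJ, map_neg] at h2
  exact neg_injective h2
end

/-- Let `J` be a generalized complex structure on `V` and let
`J_ℂ = J.baseChange ℂ` and `Pc` denote the ℂ-linear and ℂ-bilinear extensions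
of `J` and of the natural pairing `P` to the complexification
`𝕍 ⊗ ℂ = ℂ ⊗[ℝ] 𝕍`.  Then the `+i`-eigenspace `L` of `J_ℂ` is isotropic for
`Pc` (i.e. `Pc v w = 0` for all `v, w ∈ L`) and has complex dimension
`m = dim_ℝ V`; that is, `L` is a maximal isotropic subspace of `𝕍 ⊗ ℂ`. -/
theorem eigenspace_of_gcs_is_maximal_isotropic
    (V : Type*) [AddCommGroup V] [Module ℝ V] [FiniteDimensional ℝ V]
    (P : (V × Module.Dual ℝ V) → (V × Module.Dual ℝ V) → ℝ)
    (hP : ∀ v w : V × Module.Dual ℝ V, P v w = (w.2 v.1 + v.2 w.1) / 2)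
    (J : (V × Module.Dual ℝ V) →ₗ[ℝ] (V × Module.Dual ℝ V))
    (hJ2 : J ∘ₗ J = -LinearMap.id)
    (horth : ∀ v w, P (J v) (J w) = P v w)
    (Pc : LinearMap.BilinForm ℂ (ℂ ⊗[ℝ] (V × Module.Dual ℝ V)))
    (hPc : ∀ v w : V × Module.Dual ℝ V,
      Pc ((1 : ℂ) ⊗ₜ[ℝ] v) ((1 : ℂ) ⊗ₜ[ℝ] w) = (P v w : ℂ))
    (L : Submodule ℂ (ℂ ⊗[ℝ] (V × Module.Dual ℝ V)))
    (hL : ∀ v : ℂ ⊗[ℝ] (V × Module.Dual ℝ V),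
      v ∈ L ↔ J.baseChange ℂ v = Complex.I • v) :
    (∀ v ∈ L, ∀ w ∈ L, Pc v w = 0) ∧
    Module.rank ℂ L = (Module.finrank ℝ V : Cardinal) := by
  have hJ : ∀ w, J (J w) = -w := fun w => by
    simpa using LinearMap.congr_fun hJ2 w
  have hneg : ∀ v w, P v (-w) = - P v w := fun v w => by
    rw [hP, hP]; simp; ring
  constructor
  · intro v hv w hw
    have h1 := gcs_mem hJ ((hL v).1 hv)
    have h2 := gcs_mem hJ ((hL w).1 hw)
    rw [gcs_decomp v, gcs_decomp w, h1, h2]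
    generalize gcsIm _ v = b
    generalize gcsIm _ w = d
    have h3 : P b (J d) = - P (J b) d := by
      rw [← horth b (J d), hJ, hneg]
    simp only [map_add, map_smul, LinearMap.add_apply, LinearMap.smul_apply, hPc, horth, h3,
      smul_eq_mul]
    push_cast
    linear_combination (P b d : ℂ) * Complex.I_mul_I
  · let g : L →ₗ[ℝ] (V × Module.Dual ℝ V) := gcsIm _ ∘ₗ (L.subtype.restrictScalars ℝ)
    have hg : ∀ x : L, g x = gcsIm _ (x : ℂ ⊗[ℝ] (V × Module.Dual ℝ V)) := fun x => rfl
    have hbij : Function.Bijective g := by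
      constructor
      · intro x y hxy
        rw [hg, hg] at hxy
        apply Subtype.ext
        rw [gcs_decomp (x : ℂ ⊗[ℝ] (V × Module.Dual ℝ V)),
          gcs_decomp (y : ℂ ⊗[ℝ] (V × Module.Dual ℝ V)),
          gcs_mem hJ ((hL x).1 x.2), gcs_mem hJ ((hL y).1 y.2), hxy]
      · intro b
        refine ⟨⟨(1 : ℂ) ⊗ₜ[ℝ] J b + Complex.I • ((1 : ℂ) ⊗ₜ[ℝ] b), ?_⟩, ?_⟩
        · rw [hL, map_add, map_smul, LinearMap.baseChange_tmul, LinearMap.baseChange_tmul, hJ,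
            smul_add, smul_smul, Complex.I_mul_I, TensorProduct.tmul_neg, neg_one_smul, add_comm]
        · rw [hg]
          simp only [map_add, TensorProduct.smul_tmul', gcsIm_tmul]
          simp
    have e := (LinearEquiv.ofBijective g hbij).finrank_eq
    have h2 := finrank_real_of_complex L
    have h3 := h2.symm.trans e
    rw [Module.finrank_prod, Subspace.dual_finrank_eq] at h3
    rw [← Module.finrank_eq_rank]
    congr 1
    omega
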